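/- Let m be a σ-finite measure on a measurable space X, f : X → ℝ measurable, q ∈ (0,1), and let p and p' be probability densities with respect to m (p' the current proposal, p the next one). Let W_{p'}^f be the preference function associated with p' and the indicator weighting w(u) = 1_{u ≤ q}, and let Q_p^q(f), Q_{p'}^q(f) be the q-quantiles of f under p and p'. If ∫ W_{p'}^f(x) p(x) m(dx) > q, then Q_p^q(f) ≤ Q_{p'}^q(f). -/

import Mathlib

open MeasureTheory Set

noncomputable section

variable {X : Type*} [MeasurableSpace X]

/-- `P_{X∼p}[f(X) ≤ u]` for a density `p` w.r.t. `m`. -/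
def probLe (m : Measure X) (p f : X → ℝ) (u : ℝ) : ℝ := ∫ x in {y | f y ≤ u}, p x ∂m

/-- `P_{X∼p}[f(X) ≥ u]` for a density `p` w.r.t. `m`. -/
def probGe (m : Measure X) (p f : X → ℝ) (u : ℝ) : ℝ := ∫ x in {y | u ≤ f y}, p x ∂m

/-- The `q`-quantile `Q_p^q(f)`: the supremum of the `u` with
`P[f(X) ≤ u] ≥ q` and `P[f(X) ≥ u] ≥ 1 - q`. -/
def quantQ (m : Measure X) (p f : X → ℝ) (q : ℝ) : ℝ :=
  sSup {u : ℝ | q ≤ probLe m p f u ∧ 1 - q ≤ probGe m p f u}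

/-- `q_p^≤(x) = P_{X∼p}[f(X) ≤ f(x)]`. -/
def qle (m : Measure X) (p f : X → ℝ) (x : X) : ℝ := ∫ y in {y | f y ≤ f x}, p y ∂m

/-- `q_p^<(x) = P_{X∼p}[f(X) < f(x)]`. -/
def qlt (m : Measure X) (p f : X → ℝ) (x : X) : ℝ := ∫ y in {y | f y < f x}, p y ∂m

/-- The preference function `W_p^f` for the indicator weighting `w(u) = 1_{u ≤ q}`. -/
def prefW (m : Measure X) (p f : X → ℝ) (q : ℝ) (x : X) : ℝ :=
  if qle m p f x = qlt m p f x then (if qle m p f x ≤ q then 1 else 0)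
  else (min (qle m p f x) q - min (qlt m p f x) q) / (qle m p f x - qlt m p f x)

theorem aux_nonempty (ν : Measure ℝ) [IsProbabilityMeasure ν] (q : ℝ) (hq : q ∈ Ioo (0:ℝ) 1) :
    {u : ℝ | q ≤ ν.real (Iic u) ∧ 1 - q ≤ ν.real (Ici u)}.Nonempty := by
  have htop := ProbabilityTheory.tendsto_cdf_atTop ν
  have hbot := ProbabilityTheory.tendsto_cdf_atBot ν
  obtain ⟨a, ha⟩ := (htop.eventually (lt_mem_nhds hq.2)).exists
  obtain ⟨b, hb⟩ := (hbot.eventually (gt_mem_nhds hq.1)).exists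
  have hmono := ProbabilityTheory.monotone_cdf ν
  let A := {u : ℝ | q ≤ ProbabilityTheory.cdf ν u}
  have hA : A.Nonempty := ⟨a, ha.le⟩
  have hAb : BddBelow A := by
    refine ⟨b, fun u hu => ?_⟩
    by_contra! h
    have h1 : ProbabilityTheory.cdf ν u ≤ ProbabilityTheory.cdf ν b := hmono h.le
    have h2 : q ≤ ProbabilityTheory.cdf ν u := hu
    linarith
  refine ⟨sInf A, ?_, ?_⟩
  · rw [← ProbabilityTheory.cdf_eq_real]
    have hr := (ProbabilityTheory.cdf ν).right_continuous (sInf A)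
    have hr' : Filter.Tendsto (ProbabilityTheory.cdf ν) (nhdsWithin (sInf A) (Ioi (sInf A)))
        (nhds (ProbabilityTheory.cdf ν (sInf A))) :=
      hr.tendsto.mono_left (nhdsWithin_mono _ Ioi_subset_Ici_self)
    refine ge_of_tendsto hr' ?_
    filter_upwards [self_mem_nhdsWithin] with u hu
    obtain ⟨v, hv, hvu⟩ := exists_lt_of_csInf_lt hA hu
    exact le_trans hv (hmono hvu.le)
  · have h1 : ν.real (Iio (sInf A)) ≤ q := by
      have hm : ν (Iio (sInf A)) = ENNReal.ofReal
          (Function.leftLim (ProbabilityTheory.cdf ν) (sInf A) - 0) := by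
        conv_lhs => rw [← ProbabilityTheory.measure_cdf ν]
        exact StieltjesFunction.measure_Iio _ hbot _
      have hl : Function.leftLim (ProbabilityTheory.cdf ν) (sInf A) ≤ q := by
        refine le_of_tendsto (hmono.tendsto_leftLim (sInf A)) ?_
        filter_upwards [self_mem_nhdsWithin] with u hu
        by_contra! h
        exact absurd (csInf_le hAb (show u ∈ A from h.le)) (not_le.mpr hu)
      rw [measureReal_def, hm, sub_zero]
      exact ENNReal.toReal_le_of_le_ofReal hq.1.le (ENNReal.ofReal_le_ofReal hl)
    have h2 : ν.real (Iio (sInf A))ᶜ = 1 - ν.real (Iio (sInf A)) :=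
      probReal_compl_eq_one_sub measurableSet_Iio
    rw [compl_Iio] at h2
    linarith

theorem aux_bdd (ν : Measure ℝ) [IsProbabilityMeasure ν] (q : ℝ) (hq : q ∈ Ioo (0:ℝ) 1) :
    BddAbove {u : ℝ | q ≤ ν.real (Iic u) ∧ 1 - q ≤ ν.real (Ici u)} := by
  obtain ⟨a, ha⟩ := ((ProbabilityTheory.tendsto_cdf_atTop ν).eventually (lt_mem_nhds hq.2)).exists
  rw [ProbabilityTheory.cdf_eq_real] at ha
  refine ⟨a, fun u hu => ?_⟩
  by_contra! h
  have h2 : ν.real (Iic a)ᶜ = 1 - ν.real (Iic a) :=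
    probReal_compl_eq_one_sub measurableSet_Iic
  rw [compl_Iic] at h2
  have h3 : ν.real (Ici u) ≤ ν.real (Ioi a) := measureReal_mono (fun x hx => lt_of_lt_of_le h hx)
  linarith [hu.2]

theorem aux_repr (m : Measure X) (f : X → ℝ) (hf : Measurable f) (p : X → ℝ)
    (hp_nonneg : ∀ x, 0 ≤ p x)
    (hp_int : Integrable p m) (hp_one : ∫ x, p x ∂m = 1) :
    ∃ ν : Measure ℝ, IsProbabilityMeasure ν ∧
      ∀ s, MeasurableSet s → ∫ x in f ⁻¹' s, p x ∂m = ν.real s := by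
  have key : ∀ s, MeasurableSet s → ∫ x in f ⁻¹' s, p x ∂m =
      ((m.withDensity fun x => ENNReal.ofReal (p x)).map f).real s := by
    intro s hs
    rw [measureReal_def, Measure.map_apply hf hs, withDensity_apply _ (hf hs),
      integral_eq_lintegral_of_nonneg_ae (Filter.Eventually.of_forall hp_nonneg)
        hp_int.aestronglyMeasurable.restrict]
  refine ⟨_, ⟨?_⟩, key⟩
  rw [Measure.map_apply hf MeasurableSet.univ, preimage_univ, withDensity_apply _ MeasurableSet.univ,
    Measure.restrict_univ, ← ofReal_integral_eq_lintegral_ofReal hp_int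
      (Filter.Eventually.of_forall hp_nonneg), hp_one, ENNReal.ofReal_one]

/-- **Lemma 8 (first part), Akimoto et al.**: if `∫ W_{p'}^f p dm > q` then
`Q_p^q(f) ≤ Q_{p'}^q(f)`. -/
theorem objective_increase_implies_quantile_improvement
    (m : Measure X) [SigmaFinite m]
    (f : X → ℝ) (hf : Measurable f) (q : ℝ) (hq : q ∈ Ioo (0:ℝ) 1)
    (p p' : X → ℝ)
    (hp_meas : Measurable p) (hp_nonneg : ∀ x, 0 ≤ p x)
    (hp_int : Integrable p m) (hp_one : ∫ x, p x ∂m = 1)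
    (hp'_meas : Measurable p') (hp'_nonneg : ∀ x, 0 ≤ p' x)
    (hp'_int : Integrable p' m) (hp'_one : ∫ x, p' x ∂m = 1)
    (hJ : q < ∫ x, prefW m p' f q x * p x ∂m) :
    quantQ m p f q ≤ quantQ m p' f q := by
  obtain ⟨ν, hν, hrep⟩ := aux_repr m f hf p hp_nonneg hp_int hp_one
  obtain ⟨ν', hν', hrep'⟩ := aux_repr m f hf p' hp'_nonneg hp'_int hp'_one
  have e1 : ∀ u, probLe m p f u = ν.real (Iic u) := fun u => hrep _ measurableSet_Iic
  have e2 : ∀ u, probGe m p f u = ν.real (Ici u) := fun u => hrep _ measurableSet_Ici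
  have e1' : ∀ u, probLe m p' f u = ν'.real (Iic u) := fun u => hrep' _ measurableSet_Iic
  have e2' : ∀ u, probGe m p' f u = ν'.real (Ici u) := fun u => hrep' _ measurableSet_Ici
  have e3 : ∀ x, qle m p' f x = ν'.real (Iic (f x)) := fun x => hrep' _ measurableSet_Iic
  have e4 : ∀ x, qlt m p' f x = ν'.real (Iio (f x)) := fun x => hrep' _ measurableSet_Iio
  have hne := aux_nonempty ν q hq
  have hne' := aux_nonempty ν' q hq
  have hbd' := aux_bdd ν' q hq
  unfold quantQ
  simp only [e1, e2, e1', e2']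
  set Q := sSup {u : ℝ | q ≤ ν'.real (Iic u) ∧ 1 - q ≤ ν'.real (Ici u)} with hQ
  have hlt : ∀ u, Q < u → q < ν'.real (Iio u) := by
    intro u hu
    obtain ⟨s, hs⟩ := hne'
    have hsQ : s ≤ Q := le_csSup hbd' hs
    have h1 : ν'.real (Iic s) ≤ ν'.real (Iic u) :=
      measureReal_mono (Iic_subset_Iic.mpr (hsQ.trans hu.le))
    have h2 : ν'.real (Ici u) < 1 - q := by
      by_contra! h
      exact absurd (le_csSup hbd' ⟨hs.1.trans h1, h⟩) (not_le.mpr hu)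
    have h3 : ν'.real (Iio u)ᶜ = 1 - ν'.real (Iio u) :=
      probReal_compl_eq_one_sub measurableSet_Iio
    rw [compl_Iio] at h3
    linarith
  have hmono : ∀ x, ν'.real (Iio (f x)) ≤ ν'.real (Iic (f x)) :=
    fun x => measureReal_mono Iio_subset_Iic_self
  have hW0 : ∀ x, Q < f x → prefW m p' f q x = 0 := by
    intro x hx
    have h := hlt _ hx
    have h' := hmono x
    unfold prefW
    rw [e3, e4, if_neg (not_le.mpr (h.trans_le h')), min_eq_right h.le,
      min_eq_right (h.trans_le h').le]
    simp
  have hW1 : ∀ x, prefW m p' f q x ≤ 1 := by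
    intro x
    have h' := hmono x
    unfold prefW
    rw [e3, e4]
    split_ifs with h1 h2
    · exact le_rfl
    · exact zero_le_one
    · have : ν'.real (Iio (f x)) < ν'.real (Iic (f x)) := lt_of_le_of_ne h' (Ne.symm h1)
      rw [div_le_one (by linarith)]
      rcases le_total (ν'.real (Iic (f x))) q with h | h <;>
      rcases le_total (ν'.real (Iio (f x))) q with h3 | h3 <;>
      simp only [h, h3, min_eq_left, min_eq_right] <;> linarith
  have hint : Integrable (fun x => prefW m p' f q x * p x) m := by
    by_contra h
    rw [integral_undef h] at hJ
    linarith [hq.1]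
  have hmeas : MeasurableSet (f ⁻¹' Iic Q) := hf measurableSet_Iic
  have hle : ∫ x, prefW m p' f q x * p x ∂m ≤ ν.real (Iic Q) := by
    rw [← hrep _ measurableSet_Iic, ← integral_indicator hmeas]
    refine integral_mono hint (hp_int.indicator hmeas) fun x => ?_
    by_cases hx : f x ≤ Q
    · have : x ∈ f ⁻¹' Iic Q := hx
      simp only [indicator_of_mem this]
      exact mul_le_of_le_one_left (hp_nonneg x) (hW1 x)
    · have : x ∉ f ⁻¹' Iic Q := hx
      simp only [indicator_of_notMem this, hW0 x (not_le.mp hx), zero_mul, le_refl]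
  refine csSup_le hne fun u hu => ?_
  by_contra! h
  have h2 : ν.real (Iic Q)ᶜ = 1 - ν.real (Iic Q) :=
    probReal_compl_eq_one_sub measurableSet_Iic
  rw [compl_Iic] at h2
  have h3 : ν.real (Ici u) ≤ ν.real (Ioi Q) := measureReal_mono (fun x hx => lt_of_lt_of_le h hx)
  linarith [hu.2]
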